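/- arXiv:2304.14455 — 2 statements merged into one kernel-verified Lean document; each statement's English description precedes it below -/
import Mathlib

section
/- Let ι be a finite index set, and for each i ∈ ι let W_i be an n × n symmetric real matrix all of whose eigenvalues lie in the interval (−1, 1]. Let c : ι → ℝ with c_i > 0 and Σ_i c_i = 1. Suppose the only vector x ∈ ℝ^n satisfying W_i x = x for all i ∈ ι is x = 0. Then every real eigenvalue μ of the matrix S = Σ_i c_i W_i² satisfies 0 ≤ μ < 1; in particular the spectral radius of S is strictly less than 1. -/
open Matrix Finset

lemma aux_key {n : ℕ} (A : Matrix (Fin n) (Fin n) ℝ) (hA : A.IsSymm)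
    (heig : ∀ (μ : ℝ) (x : Fin n → ℝ), x ≠ 0 → A.mulVec x = μ • x → -1 < μ ∧ μ ≤ 1) :
    (1 - A * A).PosSemidef := by
  have hH : (1 - A * A).IsHermitian := by
    have h : (1 - A * A)ᵀ = 1 - A * A := by
      rw [transpose_sub, transpose_mul, hA.eq, transpose_one]
    rw [Matrix.IsHermitian, conjTranspose_eq_transpose_of_trivial, h]
  rw [hH.posSemidef_iff_eigenvalues_nonneg]
  intro j
  by_contra hneg
  have hl : hH.eigenvalues j < 0 := by simpa using hneg
  have hv := hH.mulVec_eigenvectorBasis j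
  have hv0 : (hH.eigenvectorBasis j).ofLp ≠ 0 := by
    intro h
    exact hH.eigenvectorBasis.orthonormal.ne_zero j (by ext i; exact congrFun h i)
  generalize hH.eigenvalues j = l at *
  generalize (hH.eigenvectorBasis j).ofLp = v at *
  rw [sub_mulVec, one_mulVec, ← mulVec_mulVec] at hv
  obtain ⟨s, hs, hs2⟩ : ∃ s : ℝ, 1 < s ∧ s * s = 1 - l :=
    ⟨Real.sqrt (1 - l), by
      rw [Real.lt_sqrt (by norm_num)]; linarith, Real.mul_self_sqrt (by linarith)⟩
  have hAA : A *ᵥ (A *ᵥ v) = (s * s) • v := by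
    rw [hs2, sub_smul, one_smul, ← hv]; abel
  by_cases hw : A *ᵥ v + s • v = 0
  · have := heig (-s) v hv0 (by rw [neg_smul]; exact eq_neg_of_add_eq_zero_left hw)
    linarith
  · have := heig s _ hw (by
      rw [mulVec_add, hAA, mulVec_smul, smul_add, smul_smul]; abel)
    linarith

lemma aux_quad {n : ℕ} (A : Matrix (Fin n) (Fin n) ℝ) (hA : A.IsSymm) (x : Fin n → ℝ) :
    x ⬝ᵥ ((A * A) *ᵥ x) = (A *ᵥ x) ⬝ᵥ (A *ᵥ x) := by
  rw [← mulVec_mulVec, dotProduct_mulVec, ← mulVec_transpose, hA.eq]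

lemma aux_fix {n : ℕ} (A : Matrix (Fin n) (Fin n) ℝ) (hA : A.IsSymm)
    (heig : ∀ (μ : ℝ) (x : Fin n → ℝ), x ≠ 0 → A.mulVec x = μ • x → -1 < μ ∧ μ ≤ 1)
    (x : Fin n → ℝ) (hx : x ⬝ᵥ ((1 - A * A) *ᵥ x) = 0) : A *ᵥ x = x := by
  have hP := aux_key A hA heig
  have h0 : (1 - A * A) *ᵥ x = 0 := (hP.dotProduct_mulVec_zero_iff x).1 (by simpa using hx)
  rw [sub_mulVec, one_mulVec, ← mulVec_mulVec, sub_eq_zero] at h0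
  by_contra hne
  have := heig (-1) (A *ᵥ x - x) (sub_ne_zero.2 hne) (by
    rw [mulVec_sub, ← h0, neg_smul, one_smul]; abel)
  linarith [this.1]

/-- If each symmetric `W i` has all eigenvalues in `(−1, 1]`, the weights `c i > 0` sum
to 1, and the only common fixed point of all the `W i` is `0`, then every real
eigenvalue `μ` of `S = ∑ i, c i • W i²` satisfies `0 ≤ μ < 1`. -/
theorem stmt_14 (ι : Type*) [Fintype ι] (n : ℕ)
    (W : ι → Matrix (Fin n) (Fin n) ℝ)
    (hsym : ∀ i, (W i).IsSymm)
    (heig : ∀ (i : ι) (μ : ℝ) (x : Fin n → ℝ), x ≠ 0 →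
      (W i).mulVec x = μ • x → -1 < μ ∧ μ ≤ 1)
    (c : ι → ℝ) (hc : ∀ i, 0 < c i) (hsum : ∑ i, c i = 1)
    (htriv : ∀ x : Fin n → ℝ, (∀ i, (W i).mulVec x = x) → x = 0) :
    ∀ (μ : ℝ) (x : Fin n → ℝ), x ≠ 0 →
      (∑ i, c i • (W i * W i)).mulVec x = μ • x → 0 ≤ μ ∧ μ < 1 := by
  intro μ x hx h
  have hpos : 0 < x ⬝ᵥ x := by
    have := dotProduct_star_self_pos_iff (v := x)
    simpa using this.2 hx
  have hE : μ * (x ⬝ᵥ x) = ∑ i, c i * (x ⬝ᵥ ((W i * W i) *ᵥ x)) := by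
    have h2 := congrArg (fun y => x ⬝ᵥ y) h
    simp only [sum_mulVec, dotProduct_sum, smul_mulVec, dotProduct_smul, smul_eq_mul] at h2
    exact h2.symm
  constructor
  · have : 0 ≤ μ * (x ⬝ᵥ x) := by
      rw [hE]
      refine Finset.sum_nonneg fun i _ => mul_nonneg (hc i).le ?_
      rw [aux_quad _ (hsym i)]
      exact Finset.sum_nonneg fun j _ => mul_self_nonneg _
    exact nonneg_of_mul_nonneg_left this hpos
  · by_contra! hμ
    have hnn : ∀ i ∈ Finset.univ, 0 ≤ c i * (x ⬝ᵥ ((1 - W i * W i) *ᵥ x)) := fun i _ =>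
      mul_nonneg (hc i).le (by
        simpa using (aux_key _ (hsym i) (heig i)).dotProduct_mulVec_nonneg x)
    have hS : ∑ i, c i * (x ⬝ᵥ ((1 - W i * W i) *ᵥ x)) = (1 - μ) * (x ⬝ᵥ x) := by
      simp only [sub_mulVec, one_mulVec, dotProduct_sub, mul_sub, Finset.sum_sub_distrib]
      rw [← hE, ← Finset.sum_mul, hsum]; ring
    have hz : ∑ i, c i * (x ⬝ᵥ ((1 - W i * W i) *ᵥ x)) = 0 :=
      le_antisymm (by rw [hS]; nlinarith) (Finset.sum_nonneg hnn)
    rw [Finset.sum_eq_zero_iff_of_nonneg hnn] at hz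
    exact hx (htriv x fun i => aux_fix _ (hsym i) (heig i) x
      ((mul_eq_zero.1 (hz i (Finset.mem_univ i))).resolve_left (hc i).ne'))
end

section
/- Let ι be a finite index set, for each i ∈ ι let W_i be an n × n real matrix, and let c : ι → ℝ with c_i ≥ 0 and Σ_i c_i = 1. Set S = Σ_i c_i W_iᵀ W_i, and suppose ρ ≥ 0 satisfies yᵀ S y ≤ ρ ‖y‖² for all y ∈ ℝ^n. Then for every k ∈ ℕ, every nonzero x ∈ ℝ^n, and every ε > 0, the total weight of the bad sequences satisfies: Σ over all sequences σ : {0,…,k−1} → ι such that ‖W_{σ(k−1)} ⋯ W_{σ(0)} x‖ ≥ ε ‖x‖ of (Π_{t<k} c_{σ(t)}) ≤ ε^{−2} ρ^k. -/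
open Matrix Finset
open scoped Classical

/-- Euclidean norm of a vector in `Fin n → ℝ`. -/
noncomputable def euclNorm {n : ℕ} (x : Fin n → ℝ) : ℝ := Real.sqrt (x ⬝ᵥ x)

/-- `iterMulVec W k σ x = W (σ (k−1)) ⋯ W (σ 1) (W (σ 0) x)`: the result of applying
the matrices indexed by the sequence `σ` to `x`, in order. -/
def iterMulVec {ι : Type*} {n : ℕ} (W : ι → Matrix (Fin n) (Fin n) ℝ) :
    (k : ℕ) → (Fin k → ι) → (Fin n → ℝ) → (Fin n → ℝ)
  | 0, _, x => x
  | k + 1, σ, x => (W (σ (Fin.last k))).mulVec (iterMulVec W k (fun t => σ t.castSucc) x)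

theorem euclNorm_sq {n : ℕ} (x : Fin n → ℝ) : euclNorm x ^ 2 = x ⬝ᵥ x := by
  unfold euclNorm
  apply Real.sq_sqrt
  exact Finset.sum_nonneg fun i _ => mul_self_nonneg (x i)

theorem second_moment_step {ι : Type*} [Fintype ι] {n : ℕ}
    (W : ι → Matrix (Fin n) (Fin n) ℝ) (c : ι → ℝ) (y : Fin n → ℝ) :
    y ⬝ᵥ (∑ i, c i • ((W i)ᵀ * W i)).mulVec y
      = ∑ i, c i * euclNorm ((W i).mulVec y) ^ 2 := by
  rw [Matrix.sum_mulVec, dotProduct_sum]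
  refine Finset.sum_congr rfl fun i _ => ?_
  rw [euclNorm_sq, Matrix.smul_mulVec, dotProduct_smul, smul_eq_mul,
    ← Matrix.mulVec_mulVec, Matrix.dotProduct_mulVec, Matrix.vecMul_transpose]

theorem second_moment {ι : Type*} [Fintype ι] {n : ℕ}
    (W : ι → Matrix (Fin n) (Fin n) ℝ)
    (c : ι → ℝ) (hc : ∀ i, 0 ≤ c i) (ρ : ℝ) (hρ : 0 ≤ ρ)
    (hS : ∀ y : Fin n → ℝ,
      y ⬝ᵥ (∑ i, c i • ((W i)ᵀ * W i)).mulVec y ≤ ρ * euclNorm y ^ 2)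
    (x : Fin n → ℝ) (k : ℕ) :
    ∑ σ : Fin k → ι, (∏ t, c (σ t)) * euclNorm (iterMulVec W k σ x) ^ 2
      ≤ ρ ^ k * euclNorm x ^ 2 := by
  induction k with
  | zero => simp [iterMulVec]
  | succ k ih =>
    rw [← (Fin.snocEquiv (fun _ : Fin (k + 1) => ι)).sum_comp, Fintype.sum_prod_type_right]
    calc _ = ∑ σ : Fin k → ι, (∏ t, c (σ t)) *
            ∑ i, c i * euclNorm ((W i).mulVec (iterMulVec W k σ x)) ^ 2 := by
          refine Finset.sum_congr rfl fun σ _ => ?_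
          rw [Finset.mul_sum]
          refine Finset.sum_congr rfl fun i _ => ?_
          simp [Fin.snocEquiv, iterMulVec, Fin.prod_univ_castSucc, mul_assoc]
      _ ≤ ∑ σ : Fin k → ι, (∏ t, c (σ t)) * (ρ * euclNorm (iterMulVec W k σ x) ^ 2) := by
          refine Finset.sum_le_sum fun σ _ => ?_
          refine mul_le_mul_of_nonneg_left ?_ (Finset.prod_nonneg fun t _ => hc _)
          rw [← second_moment_step]
          exact hS _
      _ = ρ * ∑ σ : Fin k → ι, (∏ t, c (σ t)) * euclNorm (iterMulVec W k σ x) ^ 2 := by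
          rw [Finset.mul_sum]
          exact Finset.sum_congr rfl fun σ _ => by ring
      _ ≤ ρ * (ρ ^ k * euclNorm x ^ 2) := mul_le_mul_of_nonneg_left ih hρ
      _ = _ := by ring

/-- The tail bound (Markov inequality on the second moment): the total weight of the
length-`k` index sequences `σ` for which `‖W (σ (k−1)) ⋯ W (σ 0) x‖ ≥ ε ‖x‖` is at
most `ε⁻² ρ^k`. -/
theorem stmt_16 (ι : Type*) [Fintype ι] (n : ℕ)
    (W : ι → Matrix (Fin n) (Fin n) ℝ)
    (c : ι → ℝ) (hc : ∀ i, 0 ≤ c i) (hsum : ∑ i, c i = 1)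
    (ρ : ℝ) (hρ : 0 ≤ ρ)
    (hS : ∀ y : Fin n → ℝ,
      y ⬝ᵥ (∑ i, c i • ((W i)ᵀ * W i)).mulVec y ≤ ρ * euclNorm y ^ 2) :
    ∀ (k : ℕ) (x : Fin n → ℝ), x ≠ 0 → ∀ ε : ℝ, 0 < ε →
      ∑ σ ∈ Finset.univ.filter
          (fun σ : Fin k → ι => ε * euclNorm x ≤ euclNorm (iterMulVec W k σ x)),
        ∏ t, c (σ t) ≤ ε⁻¹ ^ 2 * ρ ^ k := by
  intro k x hx ε hε
  have hpos : 0 < euclNorm x ^ 2 := by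
    rw [euclNorm_sq]
    refine lt_of_le_of_ne (Finset.sum_nonneg fun i _ => mul_self_nonneg (x i)) fun h => hx ?_
    exact dotProduct_self_eq_zero.mp h.symm
  have hx0 : 0 ≤ euclNorm x := Real.sqrt_nonneg _
  have key := second_moment W c hc ρ hρ hS x k
  have hw : ∀ σ : Fin k → ι, 0 ≤ ∏ t, c (σ t) := fun σ => Finset.prod_nonneg fun t _ => hc _
  have h1 : (∑ σ ∈ Finset.univ.filter
          (fun σ : Fin k → ι => ε * euclNorm x ≤ euclNorm (iterMulVec W k σ x)),
        ∏ t, c (σ t)) * (ε * euclNorm x) ^ 2 ≤ ρ ^ k * euclNorm x ^ 2 := by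
    refine le_trans ?_ key
    rw [Finset.sum_mul]
    refine le_trans (Finset.sum_le_sum fun σ hσ => ?_)
      (Finset.sum_le_sum_of_subset_of_nonneg (Finset.filter_subset _ _)
        fun σ _ _ => mul_nonneg (hw σ) (sq_nonneg _))
    have h := (Finset.mem_filter.mp hσ).2
    exact mul_le_mul_of_nonneg_left (pow_le_pow_left₀ (by positivity) h 2) (hw σ)
  rw [mul_pow, ← mul_assoc] at h1
  have h2 := le_of_mul_le_mul_right h1 hpos
  rw [inv_pow, inv_mul_eq_div, le_div_iff₀ (by positivity)]
  exact h2
end
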